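/- Any sequence of binary matrices whose numbers of rows and columns both tend to infinity has a subsequence that converges in cut distance to some asymmetric graphon. -/

import Mathlib

open Filter MeasureTheory
open scoped Topology

/-- The ℓ∞ norm of a matrix: the maximum absolute value of its entries. -/
noncomputable def linfNorm {m n : ℕ} (A : Matrix (Fin m) (Fin n) ℝ) : ℝ :=
  ⨆ i, ⨆ j, |A i j|

/-- The averaged Frobenius norm ‖A‖_F̄ = √( (1/(mn)) ∑ aᵢⱼ² ). -/
noncomputable def avgFrobNorm {m n : ℕ} (A : Matrix (Fin m) (Fin n) ℝ) : ℝ :=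
  Real.sqrt ((∑ i, ∑ j, (A i j) ^ 2) / (m * n))

/-- The (normalized) cut norm ‖A‖_□ = (1/(mn)) max{ |xᵀAy| : ‖x‖_∞ ≤ 1, ‖y‖_∞ ≤ 1 }. -/
noncomputable def cutNorm {m n : ℕ} (A : Matrix (Fin m) (Fin n) ℝ) : ℝ :=
  sSup {r : ℝ | ∃ (x : Fin m → ℝ) (y : Fin n → ℝ),
    (∀ i, |x i| ≤ 1) ∧ (∀ j, |y j| ≤ 1) ∧
    r = |∑ i, ∑ j, x i * A i j * y j| / (m * n)}

/-- The matrix A^{π,τ} with (i,j) entry a_{π(i) τ(j)}. -/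
def permute {m n : ℕ} (A : Matrix (Fin m) (Fin n) ℝ)
    (π : Equiv.Perm (Fin m)) (τ : Equiv.Perm (Fin n)) : Matrix (Fin m) (Fin n) ℝ :=
  fun i j => A (π i) (τ j)

/-- The cut distance δ_□(A,B) = min over permutations of ‖A^{π,τ} − B‖_□. -/
noncomputable def cutDist {m n : ℕ} (A B : Matrix (Fin m) (Fin n) ℝ) : ℝ :=
  ⨅ (π : Equiv.Perm (Fin m)) (τ : Equiv.Perm (Fin n)), cutNorm (permute A π τ - B)

/-- The m×n discrete approximation W_{m,n} of an asymmetric graphon, whose (i,j) entry is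
mn times the integral of W over the corresponding rectangle. (Indices i,j start at 0.) -/
noncomputable def graphonMatrix (W : ℝ → ℝ → ℝ) (m n : ℕ) : Matrix (Fin m) (Fin n) ℝ :=
  fun i j => (m * n : ℝ) *
    ∫ x in ((i : ℝ) / m)..(((i : ℝ) + 1) / m),
      ∫ y in ((j : ℝ) / n)..(((j : ℝ) + 1) / n), W x y

/-- An asymmetric graphon: a Borel measurable function taking values in [0,1] on [0,1]². -/
def IsGraphon (W : ℝ → ℝ → ℝ) : Prop :=
  Measurable (Function.uncurry W) ∧
    ∀ x ∈ Set.Icc (0 : ℝ) 1, ∀ y ∈ Set.Icc (0 : ℝ) 1, W x y ∈ Set.Icc (0 : ℝ) 1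

/-- A binary matrix: every entry is 0 or 1. -/
def IsBinary {m n : ℕ} (P : Matrix (Fin m) (Fin n) ℝ) : Prop :=
  ∀ i j, P i j = 0 ∨ P i j = 1

/-- The sign `±1` encoded by a Boolean. -/
def boolSign (b : Bool) : ℝ := if b then 1 else -1

lemma boolSign_mul_self (b : Bool) : boolSign b * boolSign b = 1 := by
  cases b <;> simp [boolSign]

lemma abs_boolSign (b : Bool) : |boolSign b| = 1 := by
  cases b <;> simp [boolSign]

lemma exists_boolSign_mul_eq_abs (r : ℝ) : ∃ b, boolSign b * r = |r| := by
  rcases le_total 0 r with h | h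
  · exact ⟨true, by simp [boolSign, abs_of_nonneg h]⟩
  · exact ⟨false, by simp [boolSign, abs_of_nonpos h]⟩

/-- A linear form on a cube is dominated by its value at some vertex. -/
lemma exists_boolSign_sum_ge {ι : Type*} [Fintype ι] (a : ι → ℝ) :
    ∃ p : ι → Bool, ∀ x : ι → ℝ, (∀ i, |x i| ≤ 1) →
      |∑ i, x i * a i| ≤ ∑ i, boolSign (p i) * a i := by
  choose p hp using fun i => exists_boolSign_mul_eq_abs (a i)
  refine ⟨p, fun x hx => (Finset.abs_sum_le_sum_abs _ _).trans (Finset.sum_le_sum fun i _ => ?_)⟩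
  rw [hp, abs_mul]
  exact mul_le_of_le_one_left (abs_nonneg _) (hx i)

/-- A bilinear form on a product of cubes is maximised, in absolute value, at a pair of vertices. -/
lemma exists_boolSign_bilinear_max {m n : ℕ} (R : Fin m → Fin n → ℝ) :
    ∃ (p : Fin m → Bool) (q : Fin n → Bool), ∀ (x : Fin m → ℝ) (y : Fin n → ℝ),
      (∀ i, |x i| ≤ 1) → (∀ j, |y j| ≤ 1) →
      |∑ i, ∑ j, x i * R i j * y j| ≤
        |∑ i, ∑ j, boolSign (p i) * R i j * boolSign (q j)| := by
  obtain ⟨⟨p, q⟩, hpq⟩ := Finite.exists_max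
    (fun z : (Fin m → Bool) × (Fin n → Bool) =>
      |∑ i, ∑ j, boolSign (z.1 i) * R i j * boolSign (z.2 j)|)
  refine ⟨p, q, fun x y hx hy => ?_⟩
  obtain ⟨p', hp'⟩ := exists_boolSign_sum_ge fun i => ∑ j, R i j * y j
  obtain ⟨q', hq'⟩ := exists_boolSign_sum_ge fun j => ∑ i, boolSign (p' i) * R i j
  have h1 := hp' x hx
  have h2 := hq' y hy
  have h3 := hpq (p', q')
  have e1 : ∑ i, x i * ∑ j, R i j * y j = ∑ i, ∑ j, x i * R i j * y j := by
    simp only [Finset.mul_sum, mul_assoc]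
  have e2 : ∑ i, boolSign (p' i) * ∑ j, R i j * y j
      = ∑ j, y j * ∑ i, boolSign (p' i) * R i j := by
    simp only [Finset.mul_sum]
    rw [Finset.sum_comm]
    exact Finset.sum_congr rfl fun _ _ => Finset.sum_congr rfl fun _ _ => by ring
  have e3 : ∑ j, boolSign (q' j) * ∑ i, boolSign (p' i) * R i j
      = ∑ i, ∑ j, boolSign (p' i) * R i j * boolSign (q' j) := by
    simp only [Finset.mul_sum]
    rw [Finset.sum_comm]
    exact Finset.sum_congr rfl fun _ _ => Finset.sum_congr rfl fun _ _ => by ring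
  rw [e1, e2] at h1
  rw [e3] at h2
  exact h1.trans ((le_abs_self _).trans (h2.trans ((le_abs_self _).trans h3)))

/-- Greedy cut decomposition: a matrix is successively approximated by combinations of sign
matrices of rank one, the next coefficient bounding the cut norm of the current remainder. -/
lemma exists_greedy_decomposition {m n : ℕ} (hm : 0 < m) (hn : 0 < n) (A : Fin m → Fin n → ℝ)
    (hA : ∀ i j, |A i j| ≤ 1) :
    ∃ (b : Fin m → ℕ → Bool) (d : Fin n → ℕ → Bool) (c : ℕ → ℝ),
      (∀ N, ∑ t ∈ Finset.range N, c t ^ 2 ≤ 1) ∧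
      ∀ T (x : Fin m → ℝ) (y : Fin n → ℝ), (∀ i, |x i| ≤ 1) → (∀ j, |y j| ≤ 1) →
        |∑ i, ∑ j, x i * (A i j -
          ∑ t ∈ Finset.range T, c t * boolSign (b i t) * boolSign (d j t)) * y j|
          ≤ m * n * |c T| := by
  have hmn : (0 : ℝ) < m * n := by positivity
  choose p q hpq using fun R : Fin m → Fin n → ℝ => exists_boolSign_bilinear_max R
  let γ : (Fin m → Fin n → ℝ) → ℝ := fun R =>
    (∑ i, ∑ j, boolSign (p R i) * R i j * boolSign (q R j)) / (m * n)
  have hγ : ∀ R, ∑ i, ∑ j, boolSign (p R i) * R i j * boolSign (q R j) = m * n * γ R := by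
    intro R
    simp only [γ]
    field_simp
  let step : (Fin m → Fin n → ℝ) → (Fin m → Fin n → ℝ) := fun R i j =>
    R i j - γ R * boolSign (p R i) * boolSign (q R j)
  let S : ℕ → Fin m → Fin n → ℝ := fun t => step^[t] A
  have hS : ∀ t i j, S (t + 1) i j =
      S t i j - γ (S t) * boolSign (p (S t) i) * boolSign (q (S t) j) := by
    intro t i j
    simp only [S, Function.iterate_succ_apply', step]
  have hsum : ∀ T i j, S T i j = A i j - ∑ t ∈ Finset.range T,
      γ (S t) * boolSign (p (S t) i) * boolSign (q (S t) j) := by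
    intro T i j
    induction T with
    | zero => simp [S]
    | succ T ih => rw [hS, ih, Finset.sum_range_succ]; ring
  have henergy : ∀ t, ∑ i, ∑ j, S (t + 1) i j ^ 2
      = ∑ i, ∑ j, S t i j ^ 2 - m * n * γ (S t) ^ 2 := by
    intro t
    have e : ∀ i j, S (t + 1) i j ^ 2 = S t i j ^ 2
        - 2 * γ (S t) * (boolSign (p (S t) i) * S t i j * boolSign (q (S t) j))
        + γ (S t) ^ 2 := by
      intro i j
      rw [hS]
      have h1 := boolSign_mul_self (p (S t) i)
      have h2 := boolSign_mul_self (q (S t) j)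
      linear_combination (γ (S t)) ^ 2 * (boolSign (q (S t) j) * boolSign (q (S t) j)) * h1
        + (γ (S t)) ^ 2 * h2
    simp only [e, Finset.sum_add_distrib, Finset.sum_sub_distrib, ← Finset.mul_sum, hγ]
    simp
    ring
  have htotal : ∀ N, ∑ i, ∑ j, S N i j ^ 2
      = ∑ i, ∑ j, A i j ^ 2 - m * n * ∑ t ∈ Finset.range N, γ (S t) ^ 2 := by
    intro N
    induction N with
    | zero => simp [S]
    | succ N ih => rw [henergy, ih, Finset.sum_range_succ]; ring
  refine ⟨fun i t => p (S t) i, fun j t => q (S t) j, fun t => γ (S t), fun N => ?_,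
    fun T x y hx hy => ?_⟩
  · have h0 : 0 ≤ ∑ i, ∑ j, S N i j ^ 2 :=
      Finset.sum_nonneg fun i _ => Finset.sum_nonneg fun j _ => sq_nonneg _
    have h1 : ∑ i, ∑ j, A i j ^ 2 ≤ m * n := by
      calc ∑ i, ∑ j, A i j ^ 2 ≤ ∑ _i : Fin m, ∑ _j : Fin n, (1 : ℝ) := by
            gcongr with i _ j _
            exact (sq_le_one_iff_abs_le_one _).2 (hA i j)
        _ = m * n := by simp
    rw [htotal] at h0
    have : m * n * ∑ t ∈ Finset.range N, γ (S t) ^ 2 ≤ (m * n : ℝ) * 1 := by linarith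
    exact le_of_mul_le_mul_left this hmn
  · have h := hpq (S T) x y hx hy
    rw [hγ, abs_mul, abs_of_pos hmn] at h
    simpa only [hsum] using h

/-- The integer whose binary digits are the first `t` terms of `w`. -/
def prefixCode (w : ℕ → Bool) : ℕ → ℕ
  | 0 => 0
  | t + 1 => 2 * prefixCode w t + (w t).toNat

lemma prefixCode_lt (w : ℕ → Bool) (t : ℕ) : prefixCode w t < 2 ^ t := by
  induction t with
  | zero => simp [prefixCode]
  | succ t ih =>
    have := Bool.toNat_le (w t)
    rw [prefixCode, pow_succ]
    omega

lemma boolSign_eq_prefixCode (w : ℕ → Bool) (t : ℕ) :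
    boolSign (w t) = 2 * ((prefixCode w (t + 1) : ℝ) - 2 * prefixCode w t) - 1 := by
  rw [prefixCode]
  push_cast
  cases w t <;> norm_num [boolSign]

lemma prefixCode_mono {w w' : ℕ → Bool} (h : toLex w ≤ toLex w') (t : ℕ) :
    prefixCode w t ≤ prefixCode w' t := by
  rcases h.eq_or_lt with h | h
  · rw [toLex_inj.1 h]
  · obtain ⟨s, hs, hlt⟩ := h
    replace hs : ∀ j < s, w j = w' j := hs
    replace hlt : w s < w' s := hlt
    have heq : ∀ r ≤ s, prefixCode w r = prefixCode w' r := by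
      intro r
      induction r with
      | zero => intro _; rfl
      | succ r ih => intro hr; simp only [prefixCode]; rw [ih (by omega), hs r (by omega)]
    have hgt : ∀ r, prefixCode w (s + 1 + r) < prefixCode w' (s + 1 + r) := by
      intro r
      induction r with
      | zero =>
        obtain ⟨h1, h2⟩ := Bool.lt_iff.1 hlt
        simp only [prefixCode, heq s le_rfl, h1, h2]
        simp
      | succ r ih =>
        have := Bool.toNat_le (w (s + 1 + r))
        rw [← add_assoc, prefixCode, prefixCode]
        omega
    rcases le_or_gt t s with h | h
    · exact (heq t h).le
    · obtain ⟨r, rfl⟩ := Nat.exists_eq_add_of_le h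
      exact (hgt r).le

/-- **Helly's selection theorem** for countably many sequences of monotone functions. -/
lemma exists_subseq_ae_tendsto_of_monotone {ι : Type*} [Countable ι] (g : ℕ → ι → ℝ → ℝ)
    (hmono : ∀ k t, Monotone (g k t)) (hg : ∀ k t u, g k t u ∈ Set.Icc (0 : ℝ) 1) :
    ∃ φ : ℕ → ℕ, StrictMono φ ∧
      ∀ᵐ u, ∀ t, ∃ l, Tendsto (fun k => g (φ k) t u) atTop (𝓝 l) := by
  obtain ⟨G, φ, hφ, hG⟩ := CompactSpace.tendsto_subseq
    (fun k => (fun z => ⟨g k z.1 z.2, hg _ _ _⟩ : ι × ℚ → Set.Icc (0 : ℝ) 1))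
  refine ⟨φ, hφ, ae_all_iff.2 fun t => ?_⟩
  have hlim : ∀ r : ℚ, Tendsto (fun k => g (φ k) t r) atTop (𝓝 (G (t, r))) := fun r =>
    (continuous_subtype_val.tendsto _).comp ((tendsto_pi_nhds.1 hG) (t, r))
  let L : ℝ → ℝ := fun u => liminf (fun k => g (φ k) t u) atTop
  have hble : ∀ u, IsBoundedUnder (· ≤ ·) atTop (fun k => g (φ k) t u) := fun u =>
    isBoundedUnder_of ⟨1, fun k => (hg _ _ _).2⟩
  have hbge : ∀ u, IsBoundedUnder (· ≥ ·) atTop (fun k => g (φ k) t u) := fun u =>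
    isBoundedUnder_of ⟨0, fun k => (hg _ _ _).1⟩
  have hL : Monotone L := fun u v huv =>
    liminf_le_liminf (Eventually.of_forall fun k => hmono _ _ huv) (hbge u)
      (hble v).isCoboundedUnder_ge
  have hc := hL.countable_not_continuousAt.ae_notMem volume
  filter_upwards [hc] with u hu
  have hu : ContinuousAt L u := by simpa using hu
  refine ⟨L u, tendsto_of_liminf_eq_limsup rfl (le_antisymm ?_
    (liminf_le_limsup (hble u) (hbge u))) (hble u) (hbge u)⟩
  refine ge_of_tendsto (hu.tendsto.mono_left nhdsWithin_le_nhds : Tendsto L (𝓝[>] u) _) ?_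
  filter_upwards [self_mem_nhdsWithin] with v hv
  obtain ⟨r, hur, hrv⟩ := exists_rat_btwn (show u < v from hv)
  calc limsup (fun k => g (φ k) t u) atTop ≤ limsup (fun k => g (φ k) t r) atTop :=
        limsup_le_limsup (Eventually.of_forall fun k => hmono _ _ hur.le)
          (hbge u).isCoboundedUnder_le (hble r)
    _ = L r := by rw [(hlim r).limsup_eq]; exact (hlim r).liminf_eq.symm
    _ ≤ L v := hL hrv.le

/-- The Lebesgue measure on `(0,1]`. -/
noncomputable def unitMeasure : Measure ℝ := volume.restrict (Set.Ioc 0 1)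

instance : IsProbabilityMeasure unitMeasure := ⟨by simp [unitMeasure]⟩

/-- The index of the cell of the uniform partition of `(0,1]` into `m` half-open intervals that
contains a point, extended monotonically to the real line. -/
noncomputable def cellIndex {m : ℕ} (hm : 0 < m) (u : ℝ) : Fin m :=
  ⟨min (⌈u * m⌉₊ - 1) (m - 1), by omega⟩

lemma cellIndex_mono {m : ℕ} (hm : 0 < m) : Monotone (cellIndex hm) := by
  intro u v huv
  have h : ⌈u * m⌉₊ ≤ ⌈v * m⌉₊ := Nat.ceil_mono (by gcongr)
  simp only [cellIndex, Fin.mk_le_mk]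
  omega

lemma measurable_cellIndex {m : ℕ} (hm : 0 < m) : Measurable (cellIndex hm) :=
  (cellIndex_mono hm).measurable

lemma cellIndex_eq_iff {m : ℕ} (hm : 0 < m) {u : ℝ} (hu : u ∈ Set.Ioc (0 : ℝ) 1) (i : Fin m) :
    cellIndex hm u = i ↔ u ∈ Set.Ioc ((i : ℝ) / m) (((i : ℝ) + 1) / m) := by
  have hm' : (0 : ℝ) < m := by positivity
  have hpos : 0 < ⌈u * m⌉₊ := Nat.ceil_pos.2 (mul_pos hu.1 hm')
  have hle : ⌈u * m⌉₊ ≤ m := Nat.ceil_le.2 (mul_le_of_le_one_left hm'.le hu.2)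
  have hi := i.2
  rw [Set.mem_Ioc, div_lt_iff₀ hm', le_div_iff₀ hm', Fin.ext_iff]
  simp only [cellIndex]
  rw [← Nat.lt_ceil, ← Nat.cast_add_one, ← Nat.ceil_le]
  omega

lemma cell_subset {m : ℕ} (hm : 0 < m) (i : Fin m) :
    Set.Ioc ((i : ℝ) / m) (((i : ℝ) + 1) / m) ⊆ Set.Ioc 0 1 := by
  have hm' : (0 : ℝ) < m := by positivity
  have hi : (i : ℝ) + 1 ≤ m := by exact_mod_cast i.2
  refine Set.Ioc_subset_Ioc (by positivity) ?_
  rw [div_le_one hm']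
  exact hi

lemma unitMeasure_restrict_cell {m : ℕ} (hm : 0 < m) (i : Fin m) :
    unitMeasure.restrict (cellIndex hm ⁻¹' {i}) =
      volume.restrict (Set.Ioc ((i : ℝ) / m) (((i : ℝ) + 1) / m)) := by
  rw [unitMeasure, Measure.restrict_restrict (measurable_cellIndex hm (measurableSet_singleton i))]
  congr 1
  ext u
  constructor
  · rintro ⟨h1, h2⟩
    exact (cellIndex_eq_iff hm h2 i).1 h1
  · intro h
    have h2 := cell_subset hm i h
    exact ⟨(cellIndex_eq_iff hm h2 i).2 h, h2⟩

lemma unitMeasure_real_cell {m : ℕ} (hm : 0 < m) (i : Fin m) :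
    unitMeasure.real (cellIndex hm ⁻¹' {i}) = 1 / m := by
  have hm' : (0 : ℝ) < m := by positivity
  have h := congrArg (fun μ => μ.real Set.univ) (unitMeasure_restrict_cell hm i)
  simp only [measureReal_restrict_apply_univ] at h
  rw [h, Real.volume_real_Ioc_of_le (by gcongr; linarith)]
  field_simp
  ring

/-- The Lebesgue measure on the unit square. -/
noncomputable def squareMeasure : Measure (ℝ × ℝ) := unitMeasure.prod unitMeasure

instance : IsProbabilityMeasure squareMeasure := by unfold squareMeasure; infer_instance

/-- The step function on the unit square with the given matrix of values. -/
noncomputable def stepFun {m n : ℕ} (hm : 0 < m) (hn : 0 < n) (A : Fin m → Fin n → ℝ) :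
    ℝ × ℝ → ℝ := fun z => A (cellIndex hm z.1) (cellIndex hn z.2)

lemma measurable_stepFun {m n : ℕ} (hm : 0 < m) (hn : 0 < n) (A : Fin m → Fin n → ℝ) :
    Measurable (stepFun hm hn A) :=
  (measurable_of_finite fun z : Fin m × Fin n => A z.1 z.2).comp
    (((measurable_cellIndex hm).comp measurable_fst).prodMk
      ((measurable_cellIndex hn).comp measurable_snd))

lemma integrable_of_abs_le {α : Type*} [MeasurableSpace α] {μ : Measure α} [IsFiniteMeasure μ]
    {f : α → ℝ} (hf : Measurable f) {C : ℝ} (hC : ∀ x, |f x| ≤ C) : Integrable f μ :=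
  Integrable.of_bound hf.aestronglyMeasurable C (Eventually.of_forall hC)

/-- A step function tested against a product of functions bounded by one is controlled by the
bilinear form of its matrix on the product of cubes. -/
lemma abs_integral_stepFun_mul_le {m n : ℕ} (hm : 0 < m) (hn : 0 < n) (A : Fin m → Fin n → ℝ)
    {C : ℝ} (hA : ∀ (x : Fin m → ℝ) (y : Fin n → ℝ), (∀ i, |x i| ≤ 1) → (∀ j, |y j| ≤ 1) →
      |∑ i, ∑ j, x i * A i j * y j| ≤ m * n * C)
    {x y : ℝ → ℝ} (hx : Measurable x) (hy : Measurable y) (hx1 : ∀ u, |x u| ≤ 1)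
    (hy1 : ∀ u, |y u| ≤ 1) :
    |∫ z, stepFun hm hn A z * (x z.1 * y z.2) ∂squareMeasure| ≤ C := by
  have hm' : (0 : ℝ) < m := by positivity
  have hn' : (0 : ℝ) < n := by positivity
  have key : ∀ {l : ℕ} (hl : 0 < l) {w : ℝ → ℝ}, Measurable w → (∀ u, |w u| ≤ 1) →
      ∀ i : Fin l, |l * ∫ u in cellIndex hl ⁻¹' {i}, w u ∂unitMeasure| ≤ 1 := by
    intro l hl w hw hw1 i
    have hl' : (0 : ℝ) < l := by positivity
    have h := norm_setIntegral_le_of_norm_le_const (μ := unitMeasure) (f := w) (C := 1)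
      (s := cellIndex hl ⁻¹' {i}) (measure_lt_top _ _) (fun u _ => hw1 u)
    rw [unitMeasure_real_cell, Real.norm_eq_abs] at h
    rw [abs_mul, abs_of_pos hl']
    calc l * |∫ u in cellIndex hl ⁻¹' {i}, w u ∂unitMeasure| ≤ l * (1 * (1 / l)) := by gcongr
      _ = 1 := by field_simp
  have hexp : ∀ z : ℝ × ℝ, stepFun hm hn A z * (x z.1 * y z.2) = ∑ i, ∑ j, A i j *
      ((cellIndex hm ⁻¹' {i}).indicator x z.1 * (cellIndex hn ⁻¹' {j}).indicator y z.2) := by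
    intro z
    rw [Finset.sum_eq_single (cellIndex hm z.1), Finset.sum_eq_single (cellIndex hn z.2)]
    · simp [stepFun]
    · intro j _ hj; simp [Ne.symm hj]
    · simp
    · intro i _ hi; simp [Ne.symm hi]
    · simp
  have hint : ∀ i j, Integrable (fun z : ℝ × ℝ => A i j *
      ((cellIndex hm ⁻¹' {i}).indicator x z.1 * (cellIndex hn ⁻¹' {j}).indicator y z.2))
      squareMeasure := fun i j =>
    (((integrable_of_abs_le hx hx1).indicator (measurable_cellIndex hm
      (measurableSet_singleton i))).mul_prod ((integrable_of_abs_le hy hy1).indicator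
        (measurable_cellIndex hn (measurableSet_singleton j)))).const_mul _
  simp only [hexp]
  rw [integral_finsetSum _ fun i _ => integrable_finsetSum _ fun j _ => hint i j]
  simp only [integral_finsetSum _ fun j _ => hint _ j]
  have hprod : ∀ i j, ∫ z, A i j * ((cellIndex hm ⁻¹' {i}).indicator x z.1 *
      (cellIndex hn ⁻¹' {j}).indicator y z.2) ∂squareMeasure
      = 1 / (m * n) * ((m * ∫ u in cellIndex hm ⁻¹' {i}, x u ∂unitMeasure) * A i j *
          (n * ∫ u in cellIndex hn ⁻¹' {j}, y u ∂unitMeasure)) := by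
    intro i j
    rw [integral_const_mul, squareMeasure, integral_prod_mul,
      integral_indicator (measurable_cellIndex hm (measurableSet_singleton i)),
      integral_indicator (measurable_cellIndex hn (measurableSet_singleton j))]
    field_simp
  simp only [hprod, ← Finset.mul_sum]
  rw [abs_mul, abs_of_pos (by positivity)]
  have h := hA _ _ (key hm hx hx1) (key hn hy hy1)
  calc _ ≤ 1 / (m * n : ℝ) * (m * n * C) := by gcongr
    _ = C := by field_simp

lemma graphonMatrix_eq {W : ℝ → ℝ → ℝ} (hW : Integrable (Function.uncurry W) squareMeasure)
    {m n : ℕ} (hm : 0 < m) (hn : 0 < n) (i : Fin m) (j : Fin n) :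
    graphonMatrix W m n i j = m * n *
      ∫ z in (cellIndex hm ⁻¹' {i}) ×ˢ (cellIndex hn ⁻¹' {j}), W z.1 z.2 ∂squareMeasure := by
  have hle : ∀ {l : ℕ} (_ : 0 < l) (i : Fin l), (i : ℝ) / l ≤ ((i : ℝ) + 1) / l := by
    intro l hl i; gcongr; linarith
  have h := setIntegral_prod (μ := unitMeasure) (ν := unitMeasure) (Function.uncurry W)
    (s := cellIndex hm ⁻¹' {i}) (t := cellIndex hn ⁻¹' {j}) hW.integrableOn
  simp only [Function.uncurry] at h
  rw [squareMeasure, h]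
  simp only [unitMeasure_restrict_cell, graphonMatrix, intervalIntegral.integral_of_le (hle hm i),
    intervalIntegral.integral_of_le (hle hn j)]

/-- The bilinear form of `A - W_{m,n}` is an integral against the step function of `A`. -/
lemma sum_sub_graphonMatrix_eq_integral {W : ℝ → ℝ → ℝ}
    (hW : Integrable (Function.uncurry W) squareMeasure) {m n : ℕ} (hm : 0 < m) (hn : 0 < n)
    (A : Fin m → Fin n → ℝ) (x : Fin m → ℝ) (y : Fin n → ℝ) :
    ∑ i, ∑ j, x i * (A i j - graphonMatrix W m n i j) * y j = m * n *
      ∫ z, (stepFun hm hn A z - W z.1 z.2) * (x (cellIndex hm z.1) * y (cellIndex hn z.2))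
        ∂squareMeasure := by
  have hm' : (0 : ℝ) < m := by positivity
  have hn' : (0 : ℝ) < n := by positivity
  let s : Fin m → Fin n → Set (ℝ × ℝ) := fun i j =>
    (cellIndex hm ⁻¹' {i}) ×ˢ (cellIndex hn ⁻¹' {j})
  have hs : ∀ i j, MeasurableSet (s i j) := fun i j =>
    (measurable_cellIndex hm (measurableSet_singleton i)).prod
      (measurable_cellIndex hn (measurableSet_singleton j))
  have hexp : ∀ z : ℝ × ℝ, (stepFun hm hn A z - W z.1 z.2) *
      (x (cellIndex hm z.1) * y (cellIndex hn z.2)) = ∑ i, ∑ j, x i * y j *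
        (s i j).indicator (fun z => A i j - Function.uncurry W z) z := by
    intro z
    rw [Finset.sum_eq_single (cellIndex hm z.1), Finset.sum_eq_single (cellIndex hn z.2)]
    · simp [stepFun, s, Function.uncurry]; ring
    · intro j _ hj; simp [s, Ne.symm hj]
    · simp
    · intro i _ hi; simp [s, Ne.symm hi]
    · simp
  have hsub : ∀ i j, Integrable (fun z => A i j - Function.uncurry W z) squareMeasure :=
    fun i j => (integrable_const _).sub hW
  have hint : ∀ i j, Integrable (fun z => x i * y j *
      (s i j).indicator (fun z => A i j - Function.uncurry W z) z) squareMeasure :=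
    fun i j => ((hsub i j).indicator (hs i j)).const_mul _
  simp only [hexp]
  rw [integral_finsetSum _ fun i _ => integrable_finsetSum _ fun j _ => hint i j]
  simp only [integral_finsetSum _ fun j _ => hint _ j, Finset.mul_sum]
  refine Finset.sum_congr rfl fun i _ => Finset.sum_congr rfl fun j _ => ?_
  have hvol : squareMeasure.real (s i j) = 1 / m * (1 / n) := by
    simp only [s, squareMeasure, measureReal_prod_prod, unitMeasure_real_cell]
  rw [integral_const_mul, integral_indicator (hs i j),
    integral_sub (integrable_const _) hW.integrableOn, setIntegral_const, hvol,
    graphonMatrix_eq hW hm hn]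
  simp only [s, Function.uncurry, smul_eq_mul]
  field_simp

/-- Functions on the unit square with values in `[0,1]` are weakly sequentially compact. -/
lemma exists_subseq_weak_limit (f : ℕ → ℝ × ℝ → ℝ) (hf : ∀ k, Measurable (f k))
    (hf1 : ∀ k z, f k z ∈ Set.Icc (0 : ℝ) 1) :
    ∃ φ : ℕ → ℕ, StrictMono φ ∧ ∃ W : ℝ → ℝ → ℝ, Measurable (Function.uncurry W) ∧
      (∀ x y, W x y ∈ Set.Icc (0 : ℝ) 1) ∧
      ∀ p : ℝ × ℝ → ℝ, Measurable p → (∀ z, |p z| ≤ 1) →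
        Tendsto (fun k => ∫ z, f (φ k) z * p z ∂squareMeasure) atTop
          (𝓝 (∫ z, W z.1 z.2 * p z ∂squareMeasure)) := by
  have hmem : ∀ {p : ℝ × ℝ → ℝ}, Measurable p → (∀ z, |p z| ≤ 1) → MemLp p 2 squareMeasure :=
    fun hp hp1 => MemLp.of_bound hp.aestronglyMeasurable 1 (Eventually.of_forall hp1)
  have hfabs : ∀ k z, |f k z| ≤ 1 := fun k z =>
    abs_le.2 ⟨by linarith [(hf1 k z).1], (hf1 k z).2⟩
  let F : ℕ → Lp ℝ 2 squareMeasure := fun k => (hmem (hf k) (hfabs k)).toLp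
  have hF : ∀ k, ‖F k‖ ≤ 1 := by
    intro k
    have h := Lp.norm_le_of_ae_bound (f := F k) (C := 1) zero_le_one (by
      filter_upwards [(hmem (hf k) (hfabs k)).coeFn_toLp] with z hz
      rw [hz]
      exact hfabs k z)
    simpa [measureUnivNNReal] using h
  let Λ : ℕ → WeakDual ℝ (Lp ℝ 2 squareMeasure) := fun k =>
    StrongDual.toWeakDual (InnerProductSpace.toDual ℝ _ (F k))
  have : Fact ((2 : ENNReal) ≠ ⊤) := ⟨by norm_num⟩
  obtain ⟨ℓ, -, φ, hφ, hlim⟩ := WeakDual.isSeqCompact_closedBall ℝ (Lp ℝ 2 squareMeasure) 0 1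
    (x := Λ) (fun k => by
      change InnerProductSpace.toDual ℝ _ (F k) ∈ Metric.closedBall 0 1
      simpa using hF k)
  let w : Lp ℝ 2 squareMeasure :=
    (InnerProductSpace.toDual ℝ _).symm (WeakDual.toStrongDual ℓ)
  have hconv : ∀ p : ℝ × ℝ → ℝ, Measurable p → (∀ z, |p z| ≤ 1) →
      Tendsto (fun k => ∫ z, f (φ k) z * p z ∂squareMeasure) atTop
        (𝓝 (∫ z, w z * p z ∂squareMeasure)) := by
    intro p hp hp1
    let q : Lp ℝ 2 squareMeasure := (hmem hp hp1).toLp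
    have h1 : Tendsto (fun k => Λ (φ k) q) atTop (𝓝 (ℓ q)) :=
      ((WeakDual.eval_continuous q).tendsto ℓ).comp hlim
    have h2 : ∀ k, Λ (φ k) q = ∫ z, f (φ k) z * p z ∂squareMeasure := by
      intro k
      change inner ℝ (F (φ k)) q = _
      rw [L2.inner_def]
      refine integral_congr_ae ?_
      filter_upwards [(hmem hp hp1).coeFn_toLp,
        (hmem (hf (φ k)) (hfabs (φ k))).coeFn_toLp] with z hz hz'
      rw [hz, hz']
      simp [mul_comm]
    have h3 : ℓ q = ∫ z, w z * p z ∂squareMeasure := by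
      have : inner ℝ w q = ℓ q := InnerProductSpace.toDual_symm_apply
      rw [← this, L2.inner_def]
      refine integral_congr_ae ?_
      filter_upwards [(hmem hp hp1).coeFn_toLp] with z hz
      rw [hz]
      simp [mul_comm]
    simpa only [h2, h3] using h1
  have hwint : Integrable w squareMeasure := (Lp.memLp w).integrable (by norm_num)
  have hset : ∀ s, MeasurableSet s → Tendsto (fun k => ∫ z in s, f (φ k) z ∂squareMeasure) atTop
      (𝓝 (∫ z in s, w z ∂squareMeasure)) := by
    intro s hs
    have h := hconv (s.indicator 1) (measurable_one.indicator hs) (fun z => by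
      by_cases hz : z ∈ s <;> simp [hz])
    have e : ∀ g : ℝ × ℝ → ℝ, ∫ z, g z * s.indicator 1 z ∂squareMeasure
        = ∫ z in s, g z ∂squareMeasure := by
      intro g
      rw [← integral_indicator hs]
      refine integral_congr_ae (Eventually.of_forall fun z => ?_)
      by_cases hz : z ∈ s <;> simp [hz]
    simpa only [e] using h
  have hfint : ∀ k, Integrable (f k) squareMeasure := fun k =>
    integrable_of_abs_le (hf k) (hfabs k)
  have hw0 : 0 ≤ᵐ[squareMeasure] w := ae_nonneg_of_forall_setIntegral_nonneg hwint
    fun s hs _ => ge_of_tendsto' (hset s hs) fun k =>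
      integral_nonneg fun z => (hf1 (φ k) z).1
  have hw1 : w ≤ᵐ[squareMeasure] fun _ => (1 : ℝ) :=
    ae_le_of_forall_setIntegral_le hwint (integrable_const _)
      fun s hs _ => le_of_tendsto' (hset s hs) fun k =>
        integral_mono (hfint _).integrableOn (integrable_const _) fun z => (hf1 (φ k) z).2
  have hwm : AEMeasurable w squareMeasure := hwint.1.aemeasurable
  refine ⟨φ, hφ, fun x y => max 0 (min 1 (hwm.mk w (x, y))), ?_, fun x y => ?_,
    fun p hp hp1 => ?_⟩
  · exact measurable_const.max (measurable_const.min hwm.measurable_mk)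
  · exact ⟨le_max_left _ _, max_le zero_le_one (min_le_left _ _)⟩
  · convert hconv p hp hp1 using 2
    refine integral_congr_ae ?_
    filter_upwards [hw0, hw1, hwm.ae_eq_mk] with z h0 h1 h2
    simp only [Prod.mk.eta, ← h2]
    rw [min_eq_right h1, max_eq_right (show (0 : ℝ) ≤ w z from h0)]

/-- The entries of a greedy decomposition truncated after `T` terms. -/
def greedySum {m n : ℕ} (b : Fin m → ℕ → Bool) (d : Fin n → ℕ → Bool) (c : ℕ → ℝ) (T : ℕ) :
    Fin m → Fin n → ℝ :=
  fun i j => ∑ t ∈ Finset.range T, c t * boolSign (b i t) * boolSign (d j t)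

lemma abs_le_one_of_sum_sq_le_one {c : ℕ → ℝ} (hc : ∀ N, ∑ t ∈ Finset.range N, c t ^ 2 ≤ 1)
    (t : ℕ) : |c t| ≤ 1 := by
  rw [← sq_le_one_iff_abs_le_one]
  exact (Finset.single_le_sum (fun s _ => sq_nonneg (c s))
    (Finset.self_mem_range_succ t)).trans (hc (t + 1))

/-- A sequence of step functions whose greedy decompositions converge termwise is Cauchy in cut
norm. -/
lemma eventually_abs_integral_stepFun_sub_le {m n : ℕ → ℕ} (hm : ∀ k, 0 < m k)
    (hn : ∀ k, 0 < n k) (A : ∀ k, Fin (m k) → Fin (n k) → ℝ)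
    (b : ∀ k, Fin (m k) → ℕ → Bool) (d : ∀ k, Fin (n k) → ℕ → Bool) (c : ℕ → ℕ → ℝ)
    (hc : ∀ k N, ∑ t ∈ Finset.range N, c k t ^ 2 ≤ 1)
    (hA : ∀ k T (x : Fin (m k) → ℝ) (y : Fin (n k) → ℝ), (∀ i, |x i| ≤ 1) → (∀ j, |y j| ≤ 1) →
      |∑ i, ∑ j, x i * (A k i j - greedySum (b k) (d k) (c k) T i j) * y j|
        ≤ m k * n k * |c k T|)
    (hblim : ∀ᵐ u ∂unitMeasure, ∀ t, ∃ l,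
      Tendsto (fun k => boolSign (b k (cellIndex (hm k) u) t)) atTop (𝓝 l))
    (hdlim : ∀ᵐ u ∂unitMeasure, ∀ t, ∃ l,
      Tendsto (fun k => boolSign (d k (cellIndex (hn k) u) t)) atTop (𝓝 l))
    (hclim : ∀ t, ∃ l, Tendsto (fun k => c k t) atTop (𝓝 l)) {ε : ℝ} (hε : 0 < ε) :
    ∀ᶠ p : ℕ × ℕ in atTop ×ˢ atTop, ∀ x y : ℝ → ℝ, Measurable x → Measurable y →
      (∀ u, |x u| ≤ 1) → (∀ u, |y u| ≤ 1) →
      |∫ z, stepFun (hm p.1) (hn p.1) (A p.1) z * (x z.1 * y z.2) ∂squareMeasure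
        - ∫ z, stepFun (hm p.2) (hn p.2) (A p.2) z * (x z.1 * y z.2) ∂squareMeasure| ≤ ε := by
  choose c' hc' using hclim
  obtain ⟨T, hT⟩ : ∃ T, |c' T| < ε / 4 := by
    have hsum : Summable fun t => c' t ^ 2 := summable_of_sum_range_le (fun t => sq_nonneg _)
      fun N => le_of_tendsto' (tendsto_finsetSum _ fun t _ => (hc' t).pow 2) fun k => hc k N
    have h0 := hsum.tendsto_atTop_zero.eventually_lt_const (show 0 < (ε / 4) ^ 2 by positivity)
    obtain ⟨T, hT⟩ := h0.exists
    exact ⟨T, abs_lt_of_sq_lt_sq hT (by positivity)⟩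
  let U : ℕ → ℝ × ℝ → ℝ := fun k => stepFun (hm k) (hn k) (greedySum (b k) (d k) (c k) T)
  have hUm : ∀ k, Measurable (U k) := fun k => measurable_stepFun _ _ _
  have hcabs : ∀ k t, |c k t| ≤ 1 := fun k => abs_le_one_of_sum_sq_le_one (hc k)
  have hUb : ∀ k z, |U k z| ≤ T := by
    intro k z
    simp only [U, stepFun, greedySum]
    refine (Finset.abs_sum_le_sum_abs _ _).trans ?_
    simp only [abs_mul, abs_boolSign, mul_one]
    exact (Finset.sum_le_sum fun t _ => hcabs k t).trans (by simp)
  have hUlim : ∀ᵐ z ∂squareMeasure, ∃ l, Tendsto (fun k => U k z) atTop (𝓝 l) := by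
    filter_upwards [Measure.quasiMeasurePreserving_fst.ae hblim,
      Measure.quasiMeasurePreserving_snd.ae hdlim] with z h1 h2
    choose l1 hl1 using h1
    choose l2 hl2 using h2
    exact ⟨∑ t ∈ Finset.range T, c' t * l1 t * l2 t,
      tendsto_finsetSum _ fun t _ => ((hc' t).mul (hl1 t)).mul (hl2 t)⟩
  have hUint : Tendsto (fun p : ℕ × ℕ => ∫ z, |U p.1 z - U p.2 z| ∂squareMeasure)
      (atTop ×ˢ atTop) (𝓝 0) := by
    have h := tendsto_integral_filter_of_dominated_convergence (μ := squareMeasure)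
      (l := (atTop ×ˢ atTop : Filter (ℕ × ℕ))) (F := fun p z => |U p.1 z - U p.2 z|)
      (f := fun _ => 0) (fun _ => 2 * (T : ℝ))
      (Eventually.of_forall fun p => ((hUm p.1).sub (hUm p.2)).abs.aestronglyMeasurable)
      (Eventually.of_forall fun p => Eventually.of_forall fun z => by
        rw [Real.norm_eq_abs, abs_abs]
        have h1 := abs_sub (U p.1 z) (U p.2 z)
        linarith [hUb p.1 z, hUb p.2 z])
      (integrable_const _) (by
        filter_upwards [hUlim] with z ⟨l, hl⟩
        simpa using ((hl.comp tendsto_fst).sub (hl.comp tendsto_snd)).abs)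
    simpa using h
  have hcT : ∀ᶠ k in atTop, |c k T| < ε / 4 := (hc' T).abs.eventually_lt_const hT
  filter_upwards [hUint.eventually_lt_const (show 0 < ε / 2 by positivity),
    tendsto_fst.eventually hcT, tendsto_snd.eventually hcT] with p hp h1 h2 x y hx hy hx1 hy1
  have hq : Measurable fun z : ℝ × ℝ => x z.1 * y z.2 :=
    (hx.comp measurable_fst).mul (hy.comp measurable_snd)
  have hq1 : ∀ z : ℝ × ℝ, |x z.1 * y z.2| ≤ 1 := fun z => by
    rw [abs_mul]
    exact mul_le_one₀ (hx1 _) (abs_nonneg _) (hy1 _)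
  have hstep : ∀ k (B : Fin (m k) → Fin (n k) → ℝ),
      Integrable (fun z => stepFun (hm k) (hn k) B z * (x z.1 * y z.2)) squareMeasure := by
    intro k B
    obtain ⟨C, hC⟩ := (Set.finite_range fun w : Fin (m k) × Fin (n k) => |B w.1 w.2|).bddAbove
    refine integrable_of_abs_le ((measurable_stepFun _ _ _).mul hq) (C := C) fun z => ?_
    rw [abs_mul]
    exact (mul_le_of_le_one_right (abs_nonneg _) (hq1 z)).trans
      (hC ⟨(cellIndex (hm k) z.1, cellIndex (hn k) z.2), rfl⟩)
  have hrem : ∀ k, |∫ z, stepFun (hm k) (hn k) (A k) z * (x z.1 * y z.2) ∂squareMeasure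
      - ∫ z, U k z * (x z.1 * y z.2) ∂squareMeasure| ≤ |c k T| := by
    intro k
    rw [← integral_sub (hstep k _) (hstep k _)]
    have h := abs_integral_stepFun_mul_le (hm k) (hn k) _ (hA k T) hx hy hx1 hy1
    simpa only [U, stepFun, sub_mul] using h
  have hmid : |∫ z, U p.1 z * (x z.1 * y z.2) ∂squareMeasure
      - ∫ z, U p.2 z * (x z.1 * y z.2) ∂squareMeasure| ≤ ε / 2 := by
    rw [← integral_sub (hstep _ _) (hstep _ _)]
    refine (abs_integral_le_integral_abs).trans (le_trans ?_ hp.le)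
    refine integral_mono ((hstep p.1 _).sub (hstep p.2 _)).abs ?_ fun z => ?_
    · exact ((integrable_of_abs_le (hUm _) (hUb _)).sub
        (integrable_of_abs_le (hUm _) (hUb _))).abs
    · simp only [← sub_mul]
      rw [abs_mul]
      exact mul_le_of_le_one_right (abs_nonneg _) (hq1 z)
  have e1 := abs_le.1 (hrem p.1)
  have e2 := abs_le.1 (hrem p.2)
  have e3 := abs_le.1 hmid
  rw [abs_le]
  constructor <;> linarith [e1.1, e1.2, e2.1, e2.2, e3.1, e3.2]

/-- A greedy decomposition in which rows and columns have been sorted lexicographically. -/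
lemma exists_sorted_greedy_decomposition {m n : ℕ} (hm : 0 < m) (hn : 0 < n)
    (P : Matrix (Fin m) (Fin n) ℝ) (hP : ∀ i j, |P i j| ≤ 1) :
    ∃ (π : Equiv.Perm (Fin m)) (τ : Equiv.Perm (Fin n))
      (b : Fin m → ℕ → Bool) (d : Fin n → ℕ → Bool) (c : ℕ → ℝ),
      Monotone (fun i => toLex (b i)) ∧ Monotone (fun j => toLex (d j)) ∧
      (∀ N, ∑ t ∈ Finset.range N, c t ^ 2 ≤ 1) ∧
      ∀ T (x : Fin m → ℝ) (y : Fin n → ℝ), (∀ i, |x i| ≤ 1) → (∀ j, |y j| ≤ 1) →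
        |∑ i, ∑ j, x i * (permute P π τ i j - greedySum b d c T i j) * y j| ≤ m * n * |c T| := by
  obtain ⟨b, d, c, hc, h⟩ := exists_greedy_decomposition hm hn P hP
  let π := Tuple.sort fun i => toLex (b i)
  let τ := Tuple.sort fun j => toLex (d j)
  refine ⟨π, τ, b ∘ π, d ∘ τ, c, Tuple.monotone_sort fun i => toLex (b i),
    Tuple.monotone_sort fun j => toLex (d j), hc, fun T x y hx hy => ?_⟩
  convert h T (x ∘ π.symm) (y ∘ τ.symm) (fun i => hx _) (fun j => hy _) using 2
  rw [← Equiv.sum_comp π.symm]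
  refine Finset.sum_congr rfl fun i _ => ?_
  rw [← Equiv.sum_comp τ.symm]
  simp [permute, greedySum]

lemma cutNorm_nonneg {m n : ℕ} (A : Matrix (Fin m) (Fin n) ℝ) : 0 ≤ cutNorm A := by
  refine Real.sSup_nonneg ?_
  rintro r ⟨x, y, -, -, rfl⟩
  positivity

lemma cutNorm_le {m n : ℕ} (hm : 0 < m) (hn : 0 < n) {A : Matrix (Fin m) (Fin n) ℝ} {C : ℝ}
    (hC : 0 ≤ C) (h : ∀ (x : Fin m → ℝ) (y : Fin n → ℝ), (∀ i, |x i| ≤ 1) → (∀ j, |y j| ≤ 1) →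
      |∑ i, ∑ j, x i * A i j * y j| ≤ m * n * C) : cutNorm A ≤ C := by
  refine Real.sSup_le ?_ hC
  rintro r ⟨x, y, hx, hy, rfl⟩
  rw [div_le_iff₀ (by positivity), mul_comm]
  exact h x y hx hy

lemma cutDist_nonneg {m n : ℕ} (A B : Matrix (Fin m) (Fin n) ℝ) : 0 ≤ cutDist A B :=
  Real.iInf_nonneg fun _ => Real.iInf_nonneg fun _ => cutNorm_nonneg _

lemma cutDist_le {m n : ℕ} (A B : Matrix (Fin m) (Fin n) ℝ) (π : Equiv.Perm (Fin m))
    (τ : Equiv.Perm (Fin n)) : cutDist A B ≤ cutNorm (permute A π τ - B) :=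
  (ciInf_le (Set.finite_range _).bddBelow π).trans (ciInf_le (Set.finite_range _).bddBelow τ)

lemma cutDist_graphonMatrix_le {m n : ℕ} (hm : 0 < m) (hn : 0 < n)
    (P : Matrix (Fin m) (Fin n) ℝ) {W : ℝ → ℝ → ℝ}
    (hW : Integrable (Function.uncurry W) squareMeasure) (π : Equiv.Perm (Fin m))
    (τ : Equiv.Perm (Fin n)) {C : ℝ} (hC : 0 ≤ C)
    (h : ∀ x y : ℝ → ℝ, Measurable x → Measurable y → (∀ u, |x u| ≤ 1) → (∀ u, |y u| ≤ 1) →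
      |∫ z, (stepFun hm hn (permute P π τ) z - W z.1 z.2) * (x z.1 * y z.2) ∂squareMeasure| ≤ C) :
    cutDist P (graphonMatrix W m n) ≤ C := by
  refine (cutDist_le _ _ π τ).trans (cutNorm_le hm hn hC fun x y hx hy => ?_)
  have e := sum_sub_graphonMatrix_eq_integral hW hm hn (permute P π τ) x y
  simp only [Matrix.sub_apply]
  rw [e, abs_mul, abs_of_nonneg (by positivity)]
  refine mul_le_mul_of_nonneg_left ?_ (by positivity)
  exact h _ _ ((measurable_of_finite x).comp (measurable_cellIndex hm))
    ((measurable_of_finite y).comp (measurable_cellIndex hn)) (fun _ => hx _) fun _ => hy _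

/-- Lexicographically sorted Boolean sequences, viewed as step functions, have a subsequence
along which every bit converges almost everywhere; countably many bounded scalar
sequences can be made to converge at the same time. -/
lemma exists_subseq_sorted_tendsto {m n : ℕ → ℕ} (hm : ∀ k, 0 < m k) (hn : ∀ k, 0 < n k)
    (b : ∀ k, Fin (m k) → ℕ → Bool) (d : ∀ k, Fin (n k) → ℕ → Bool) (c : ℕ → ℕ → ℝ)
    (hb : ∀ k, Monotone fun i => toLex (b k i)) (hd : ∀ k, Monotone fun j => toLex (d k j))
    (hc : ∀ k t, |c k t| ≤ 1) :
    ∃ φ : ℕ → ℕ, StrictMono φ ∧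
      (∀ᵐ u ∂unitMeasure, ∀ t, ∃ l,
        Tendsto (fun k => boolSign (b (φ k) (cellIndex (hm (φ k)) u) t)) atTop (𝓝 l)) ∧
      (∀ᵐ u ∂unitMeasure, ∀ t, ∃ l,
        Tendsto (fun k => boolSign (d (φ k) (cellIndex (hn (φ k)) u) t)) atTop (𝓝 l)) ∧
      ∀ t, ∃ l, Tendsto (fun k => c (φ k) t) atTop (𝓝 l) := by
  let code : ∀ {l : ℕ}, 0 < l → (Fin l → ℕ → Bool) → ℕ → ℝ → ℝ := fun hl w t u =>
    (prefixCode (w (cellIndex hl u)) t : ℝ) / 2 ^ t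
  have hcode : ∀ {l : ℕ} (hl : 0 < l) {w : Fin l → ℕ → Bool}, (Monotone fun i => toLex (w i)) →
      ∀ t, Monotone (code hl w t) := by
    intro l hl w hw t u v huv
    have h := prefixCode_mono (hw (cellIndex_mono hl huv)) t
    simp only [code]
    gcongr
  have hcode1 : ∀ {l : ℕ} (hl : 0 < l) (w : Fin l → ℕ → Bool) t u,
      code hl w t u ∈ Set.Icc (0 : ℝ) 1 := by
    intro l hl w t u
    refine ⟨by positivity, ?_⟩
    rw [div_le_one (by positivity)]
    exact_mod_cast (prefixCode_lt (w (cellIndex hl u)) t).le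
  let g : ℕ → (ℕ ⊕ ℕ) ⊕ ℕ → ℝ → ℝ := fun k =>
    Sum.elim (Sum.elim (code (hm k) (b k)) (code (hn k) (d k))) fun t _ => (c k t + 1) / 2
  obtain ⟨φ, hφ, hlim⟩ := exists_subseq_ae_tendsto_of_monotone g
    (by
      rintro k ((t | t) | t)
      · exact hcode _ (hb k) t
      · exact hcode _ (hd k) t
      · exact monotone_const)
    (by
      rintro k ((t | t) | t) u
      · exact hcode1 _ _ _ _
      · exact hcode1 _ _ _ _
      · have h := abs_le.1 (hc k t)
        simp only [g, Sum.elim_inr, Set.mem_Icc]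
        constructor <;> linarith [h.1, h.2])
  have hdecode : ∀ {l : ℕ → ℕ} (hl : ∀ k, 0 < l k) (w : ∀ k, Fin (l k) → ℕ → Bool) (u : ℝ),
      (∀ t, ∃ r, Tendsto (fun k => code (hl (φ k)) (w (φ k)) t u) atTop (𝓝 r)) →
      ∀ t, ∃ r, Tendsto (fun k => boolSign (w (φ k) (cellIndex (hl (φ k)) u) t)) atTop
        (𝓝 r) := by
    intro l hl w u h t
    obtain ⟨r, hr⟩ := h t
    obtain ⟨r', hr'⟩ := h (t + 1)
    refine ⟨2 * (r' * 2 ^ (t + 1) - 2 * (r * 2 ^ t)) - 1, ?_⟩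
    refine (((((hr'.mul_const _).sub ((hr.mul_const _).const_mul 2)).const_mul 2).sub_const
      1)).congr fun k => ?_
    rw [boolSign_eq_prefixCode]
    simp only [code]
    field_simp
  have hac : ∀ᵐ u ∂unitMeasure, ∀ t, ∃ l, Tendsto (fun k => g (φ k) t u) atTop (𝓝 l) :=
    ae_restrict_of_ae hlim
  refine ⟨φ, hφ, ?_, ?_, fun t => ?_⟩
  · filter_upwards [hac] with u hu
    exact hdecode hm b u fun t => hu (.inl (.inl t))
  · filter_upwards [hac] with u hu
    exact hdecode hn d u fun t => hu (.inl (.inr t))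
  · obtain ⟨u, hu⟩ := hac.exists
    obtain ⟨l, hl⟩ := hu (.inr t)
    refine ⟨2 * l - 1, ((hl.const_mul 2).sub_const 1).congr fun k => ?_⟩
    simp only [g, Sum.elim_inr]
    ring

/-- Compactness for sequences of matrices all of which are non-empty. -/
lemma exists_subseq_tendsto_cutDist_of_pos (m n : ℕ → ℕ)
    (P : ∀ k, Matrix (Fin (m k)) (Fin (n k)) ℝ) (hbin : ∀ k, IsBinary (P k))
    (hm : ∀ k, 0 < m k) (hn : ∀ k, 0 < n k) :
    ∃ φ : ℕ → ℕ, StrictMono φ ∧ ∃ W : ℝ → ℝ → ℝ, IsGraphon W ∧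
      Tendsto (fun j => cutDist (P (φ j)) (graphonMatrix W (m (φ j)) (n (φ j))))
        atTop (𝓝 0) := by
  have hP : ∀ k i j, P k i j ∈ Set.Icc (0 : ℝ) 1 := by
    intro k i j
    rcases hbin k i j with h | h <;> simp [h]
  choose π τ b d c hb hd hc hA using fun k =>
    exists_sorted_greedy_decomposition (hm k) (hn k) (P k) fun i j =>
      abs_le.2 ⟨by linarith [(hP k i j).1], (hP k i j).2⟩
  have hcabs : ∀ k t, |c k t| ≤ 1 := fun k => abs_le_one_of_sum_sq_le_one (hc k)
  obtain ⟨φ, hφ, hblim, hdlim, hclim⟩ := exists_subseq_sorted_tendsto hm hn b d c hb hd hcabs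
  let f : ℕ → ℝ × ℝ → ℝ := fun k => stepFun (hm k) (hn k) (permute (P k) (π k) (τ k))
  obtain ⟨ψ, hψ, W, hWm, hW1, hweak⟩ := exists_subseq_weak_limit (fun k => f (φ k))
    (fun k => measurable_stepFun _ _ _) (fun k z => hP _ _ _)
  refine ⟨φ ∘ ψ, hφ.comp hψ, W, ⟨hWm, fun x _ y _ => hW1 x y⟩, ?_⟩
  have hWabs : ∀ z : ℝ × ℝ, |W z.1 z.2| ≤ 1 := fun z =>
    abs_le.2 ⟨by linarith [(hW1 z.1 z.2).1], (hW1 z.1 z.2).2⟩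
  have hWint : Integrable (Function.uncurry W) squareMeasure := integrable_of_abs_le hWm hWabs
  have hfm : ∀ k, Measurable (f k) := fun k => measurable_stepFun _ _ _
  have hfabs : ∀ k z, |f k z| ≤ 1 := fun k z => by
    have h : f k z ∈ Set.Icc (0 : ℝ) 1 := hP _ _ _
    exact abs_le.2 ⟨by linarith [h.1], h.2⟩
  rw [Metric.tendsto_atTop']
  intro ε hε
  have hcauchy := eventually_abs_integral_stepFun_sub_le (fun k => hm (φ (ψ k)))
    (fun k => hn (φ (ψ k))) (fun k => permute (P (φ (ψ k))) (π (φ (ψ k))) (τ (φ (ψ k))))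
    (fun k => b (φ (ψ k))) (fun k => d (φ (ψ k))) (fun k => c (φ (ψ k)))
    (fun k => hc _) (fun k => hA _)
    (hblim.mono fun u hu t => (hu t).imp fun l hl => hl.comp hψ.tendsto_atTop)
    (hdlim.mono fun u hu t => (hu t).imp fun l hl => hl.comp hψ.tendsto_atTop)
    (fun t => (hclim t).imp fun l hl => hl.comp hψ.tendsto_atTop) (half_pos hε)
  obtain ⟨K, hK⟩ := eventually_atTop.1 hcauchy.curry
  refine ⟨K, fun k hk => ?_⟩
  rw [Real.dist_eq, sub_zero, abs_of_nonneg (cutDist_nonneg _ _)]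
  refine lt_of_le_of_lt ?_ (half_lt_self hε)
  refine cutDist_graphonMatrix_le (hm _) (hn _) _ hWint (π _) (τ _) (half_pos hε).le
    fun x y hx hy hx1 hy1 => ?_
  have hq : Measurable fun z : ℝ × ℝ => x z.1 * y z.2 :=
    (hx.comp measurable_fst).mul (hy.comp measurable_snd)
  have hq1 : ∀ z : ℝ × ℝ, |x z.1 * y z.2| ≤ 1 := fun z => by
    rw [abs_mul]
    exact mul_le_one₀ (hx1 _) (abs_nonneg _) (hy1 _)
  have hmul : ∀ g : ℝ × ℝ → ℝ, Measurable g → (∀ z, |g z| ≤ 1) →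
      Integrable (fun z => g z * (x z.1 * y z.2)) squareMeasure := fun g hg hg1 =>
    integrable_of_abs_le (hg.mul hq) (C := 1) fun z => by
      rw [abs_mul]
      exact mul_le_one₀ (hg1 z) (abs_nonneg _) (hq1 z)
  have hclose : ∀ᶠ l in atTop, |∫ z, f (φ (ψ k)) z * (x z.1 * y z.2) ∂squareMeasure
      - ∫ z, f (φ (ψ l)) z * (x z.1 * y z.2) ∂squareMeasure| ≤ ε / 2 :=
    (hK k hk.le).mono fun l hl => hl x y hx hy hx1 hy1
  have hbound := le_of_tendsto (tendsto_const_nhds.sub (hweak _ hq hq1)).abs hclose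
  rw [← integral_sub (hmul _ (hfm _) (hfabs _)) (hmul (fun z => W z.1 z.2) hWm hWabs)] at hbound
  simp only [← sub_mul] at hbound
  exact hbound

/-- Theorem 3.4 (compactness): any sequence of binary matrices whose numbers of rows and
columns both tend to infinity has a subsequence converging in cut distance to some
asymmetric graphon. -/
theorem stmt9 (m n : ℕ → ℕ) (P : ∀ k, Matrix (Fin (m k)) (Fin (n k)) ℝ)
    (hbin : ∀ k, IsBinary (P k))
    (hm : Tendsto m atTop atTop) (hn : Tendsto n atTop atTop) :
    ∃ φ : ℕ → ℕ, StrictMono φ ∧ ∃ W : ℝ → ℝ → ℝ, IsGraphon W ∧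
      Tendsto (fun j => cutDist (P (φ j)) (graphonMatrix W (m (φ j)) (n (φ j))))
        atTop (𝓝 0) := by
  obtain ⟨K, hK⟩ := eventually_atTop.1
    ((hm.eventually_gt_atTop 0).and (hn.eventually_gt_atTop 0))
  obtain ⟨φ, hφ, W, hW, hlim⟩ := exists_subseq_tendsto_cutDist_of_pos (fun k => m (k + K))
    (fun k => n (k + K)) (fun k => P (k + K)) (fun k => hbin _)
    (fun k => (hK _ (Nat.le_add_left _ _)).1) (fun k => (hK _ (Nat.le_add_left _ _)).2)
  exact ⟨fun j => φ j + K, fun i j hij => Nat.add_lt_add_right (hφ hij) K, W, hW, hlim⟩
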